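/- For δ > 0, β > 0 and every binary qubit POVM in conical coordinates (w, λ, θ, φ), the Δ-disturbance is bounded above by the quantum Fisher information: D^{(Δ)} ≤ F^Q = δ²/(2 + 2cosh(βδ)), with equality if and only if the measurement is projective, i.e. w = 1/2 and λ = 1. -/

import Mathlib

open Matrix ComplexOrder Real

noncomputable def pauliX : Matrix (Fin 2) (Fin 2) ℂ := !![0, 1; 1, 0]
noncomputable def pauliY : Matrix (Fin 2) (Fin 2) ℂ := !![0, -Complex.I; Complex.I, 0]
noncomputable def pauliZ : Matrix (Fin 2) (Fin 2) ℂ := !![1, 0; 0, -1]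

/-- The thermal qubit state `ρ_β = diag(e^{−βδ/2}, e^{βδ/2})/(2 cosh(βδ/2))`. -/
noncomputable def rhoTherm (δ β : ℝ) : Matrix (Fin 2) (Fin 2) ℂ :=
  ((2 * Real.cosh (β * δ / 2) : ℝ)⁻¹ : ℂ) •
    !![Complex.exp (-(β * δ / 2)), 0; 0, Complex.exp (β * δ / 2)]

/-- The POVM element `Π₀` of a binary qubit POVM in conical coordinates. -/
noncomputable def povm0 (w l θ φ : ℝ) : Matrix (Fin 2) (Fin 2) ℂ :=
  (w : ℂ) • ((1 : Matrix (Fin 2) (Fin 2) ℂ)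
    + ((l * Real.sin θ * Real.cos φ : ℝ) : ℂ) • pauliX
    + ((l * Real.sin θ * Real.sin φ : ℝ) : ℂ) • pauliY
    + ((l * Real.cos θ : ℝ) : ℂ) • pauliZ)

/-- The POVM element `Π₁ = I₂ − Π₀`. -/
noncomputable def povm1 (w l θ φ : ℝ) : Matrix (Fin 2) (Fin 2) ℂ :=
  1 - povm0 w l θ φ

/-- The outcome probability `p₀(β) = tr(ρ_β Π₀)`. -/
noncomputable def prob0 (δ β w l θ φ : ℝ) : ℝ :=
  ((rhoTherm δ β * povm0 w l θ φ).trace).re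

/-- The Fisher information of the measurement, `F_β = (dp₀/dβ)²/(p₀ p₁)`. -/
noncomputable def fisherInfo (δ β w l θ φ : ℝ) : ℝ :=
  (deriv (fun b => prob0 δ b w l θ φ) β) ^ 2 /
    (prob0 δ β w l θ φ * (1 - prob0 δ β w l θ φ))
/-- The quantum Fisher information `F^Q = δ²/(2 + 2cosh(βδ))` of the thermal qubit model. -/
noncomputable def qfiModel (δ β : ℝ) : ℝ := δ ^ 2 / (2 + 2 * Real.cosh (β * δ))

/-- The QFI `Q₀` of the post-measurement state for outcome 0. -/
noncomputable def qfiPost0 (δ β l θ : ℝ) : ℝ :=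
  δ ^ 2 * (1 - l ^ 2) * Real.exp (β * δ) /
    ((1 + l * Real.cos θ) + Real.exp (β * δ) * (1 - l * Real.cos θ)) ^ 2

/-- The QFI `Q₁` of the post-measurement state for outcome 1. -/
noncomputable def qfiPost1 (δ β w l θ : ℝ) : ℝ :=
  δ ^ 2 * ((1 - w) ^ 2 - l ^ 2 * w ^ 2) * Real.exp (β * δ) /
    (1 - w * (1 + l * Real.cos θ) + Real.exp (β * δ) * (1 - w * (1 - l * Real.cos θ))) ^ 2

/-- The Δ-disturbance (information loss) `D^{(Δ)} = F^Q − p₀Q₀ − p₁Q₁`. -/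
noncomputable def deltaDist (δ β w l θ φ : ℝ) : ℝ :=
  qfiModel δ β - prob0 δ β w l θ φ * qfiPost0 δ β l θ -
    (1 - prob0 δ β w l θ φ) * qfiPost1 δ β w l θ
theorem prob0_eq (δ β w l θ φ : ℝ) :
    prob0 δ β w l θ φ =
      w * (exp (-(β * δ / 2)) * (1 + l * cos θ) + exp (β * δ / 2) * (1 - l * cos θ)) /
        (exp (β * δ / 2) + exp (-(β * δ / 2))) := by
  have h : (rhoTherm δ β * povm0 w l θ φ).trace =
      (((2 * Real.cosh (β * δ / 2))⁻¹ *
        (w * (Real.exp (-(β * δ / 2)) * (1 + l * Real.cos θ) +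
          Real.exp (β * δ / 2) * (1 - l * Real.cos θ))) : ℝ) : ℂ) := by
    simp [rhoTherm, povm0, pauliX, pauliY, pauliZ, Matrix.trace_fin_two, Matrix.vecMul,
      dotProduct, Fin.sum_univ_two]
    ring
  rw [prob0, h, Complex.ofReal_re, Real.cosh_eq]
  field_simp

theorem abs_mul_cos_le_one {l : ℝ} (θ : ℝ) (h0 : 0 ≤ l) (h1 : l ≤ 1) : |l * cos θ| ≤ 1 := by
  rw [abs_mul, abs_of_nonneg h0]
  exact mul_le_one₀ h1 (abs_nonneg _) (abs_cos_le_one θ)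

theorem weighted_sum_pos {a b s t : ℝ} (ha : 0 ≤ a) (hb : 0 ≤ b) (hab : 0 < a + b)
    (hs : 0 < s) (ht : 0 < t) : 0 < s * a + t * b := by
  rcases ha.lt_or_eq with h | h
  · positivity
  · have : 0 < b := by linarith
    positivity

theorem prob0_pos {l w : ℝ} (δ β θ φ : ℝ) (hw : 0 < w) (h0 : 0 ≤ l) (h1 : l ≤ 1) :
    0 < prob0 δ β w l θ φ := by
  obtain ⟨hm, hp⟩ := abs_le.mp (abs_mul_cos_le_one θ h0 h1)
  have := weighted_sum_pos (a := 1 + l * cos θ) (b := 1 - l * cos θ) (by linarith) (by linarith)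
    (by linarith) (exp_pos (-(β * δ / 2))) (exp_pos (β * δ / 2))
  rw [prob0_eq]
  positivity

theorem prob0_lt_one {l w : ℝ} (δ β θ φ : ℝ) (hw : 0 < w) (hw2 : w ≤ 1 / 2) (h0 : 0 ≤ l)
    (h1 : l ≤ 1) : prob0 δ β w l θ φ < 1 := by
  obtain ⟨hm, hp⟩ := abs_le.mp (abs_mul_cos_le_one θ h0 h1)
  have := weighted_sum_pos (a := 1 - w * (1 + l * cos θ)) (b := 1 - w * (1 - l * cos θ))
    (by nlinarith) (by nlinarith) (by linarith) (exp_pos (-(β * δ / 2))) (exp_pos (β * δ / 2))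
  rw [prob0_eq, div_lt_one (by positivity)]
  linarith

theorem qfiPost0_nonneg {l : ℝ} (δ β θ : ℝ) (h0 : 0 ≤ l) (h1 : l ≤ 1) :
    0 ≤ qfiPost0 δ β l θ := by
  have : 0 ≤ 1 - l ^ 2 := by nlinarith
  rw [qfiPost0]
  positivity

theorem qfiPost0_eq_zero_iff {δ l : ℝ} (β θ : ℝ) (hδ : δ ≠ 0) (h0 : 0 ≤ l) (h1 : l ≤ 1) :
    qfiPost0 δ β l θ = 0 ↔ l = 1 := by
  obtain ⟨hm, hp⟩ := abs_le.mp (abs_mul_cos_le_one θ h0 h1)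
  have hd := weighted_sum_pos (a := 1 + l * cos θ) (b := 1 - l * cos θ) (by linarith)
    (by linarith) (by linarith) one_pos (exp_pos (β * δ))
  rw [one_mul] at hd
  rw [qfiPost0, div_eq_zero_iff, or_iff_left (pow_ne_zero 2 hd.ne'), mul_eq_zero,
    or_iff_left (exp_ne_zero _), mul_eq_zero, or_iff_right (pow_ne_zero 2 hδ)]
  constructor <;> intro h
  · nlinarith
  · simp [h]

theorem qfiPost1_nonneg {w l : ℝ} (δ β θ : ℝ) (hw : 0 < w) (hw2 : w ≤ 1 / 2) (h0 : 0 ≤ l)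
    (h1 : l ≤ 1) : 0 ≤ qfiPost1 δ β w l θ := by
  have hlw : l * w ≤ w := mul_le_of_le_one_left hw.le h1
  have h : 0 ≤ (1 - w) ^ 2 - l ^ 2 * w ^ 2 := by
    have := mul_nonneg (a := 1 - w - l * w) (b := 1 - w + l * w) (by linarith)
      (by nlinarith [mul_nonneg h0 hw.le])
    linarith
  rw [qfiPost1]
  positivity

theorem qfiPost1_eq_zero_iff {δ w l : ℝ} (β θ : ℝ) (hδ : δ ≠ 0) (hw : 0 < w) (hw2 : w ≤ 1 / 2)
    (h0 : 0 ≤ l) (h1 : l ≤ 1) : qfiPost1 δ β w l θ = 0 ↔ w = 1 / 2 ∧ l = 1 := by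
  obtain ⟨hm, hp⟩ := abs_le.mp (abs_mul_cos_le_one θ h0 h1)
  have hd := weighted_sum_pos (a := 1 - w * (1 + l * cos θ)) (b := 1 - w * (1 - l * cos θ))
    (by nlinarith) (by nlinarith) (by linarith) one_pos (exp_pos (β * δ))
  rw [one_mul] at hd
  rw [qfiPost1, div_eq_zero_iff, or_iff_left (pow_ne_zero 2 hd.ne'), mul_eq_zero,
    or_iff_left (exp_ne_zero _), mul_eq_zero, or_iff_right (pow_ne_zero 2 hδ)]
  constructor
  · intro h
    have hlw : l * w ≤ w := mul_le_of_le_one_left hw.le h1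
    have hlw0 : 0 ≤ l * w := mul_nonneg h0 hw.le
    have hfac : (1 - w - l * w) * (1 - w + l * w) = 0 := by linarith
    have hzero : 1 - w - l * w = 0 :=
      (mul_eq_zero.mp hfac).resolve_right (by linarith)
    have hw_eq : w = 1 / 2 := by linarith
    subst hw_eq
    exact ⟨rfl, by linarith⟩
  · rintro ⟨rfl, rfl⟩
    norm_num

/-- The Δ-disturbance is bounded above by the quantum Fisher information
`F^Q = δ²/(2+2coshβδ)`, with equality iff the measurement is projective
(`w = 1/2` and `λ = 1`). -/
theorem stmt14 (δ β : ℝ) (hδ : 0 < δ) (hβ : 0 < β) :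
    ∀ w l θ φ : ℝ, 0 < w → w ≤ 1 / 2 → 0 ≤ l → l ≤ 1 →
      0 ≤ θ → θ ≤ π → 0 ≤ φ → φ < 2 * π →
      deltaDist δ β w l θ φ ≤ qfiModel δ β ∧
      (deltaDist δ β w l θ φ = qfiModel δ β ↔ (w = 1 / 2 ∧ l = 1)) := by
  intro w l θ φ hw hw2 h0 h1 _ _ _ _
  have hp0 := prob0_pos δ β θ φ hw h0 h1
  have hp1 : 0 < 1 - prob0 δ β w l θ φ := sub_pos.mpr (prob0_lt_one δ β θ φ hw hw2 h0 h1)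
  have hA := mul_nonneg hp0.le (qfiPost0_nonneg δ β θ h0 h1)
  have hB := mul_nonneg hp1.le (qfiPost1_nonneg δ β θ hw hw2 h0 h1)
  rw [deltaDist]
  refine ⟨by linarith, fun h => ?_, fun h => ?_⟩
  · have hB0 : (1 - prob0 δ β w l θ φ) * qfiPost1 δ β w l θ = 0 := by linarith
    exact (qfiPost1_eq_zero_iff β θ hδ.ne' hw hw2 h0 h1).mp
      ((mul_eq_zero.mp hB0).resolve_left hp1.ne')
  · rw [(qfiPost1_eq_zero_iff β θ hδ.ne' hw hw2 h0 h1).mpr h,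
      (qfiPost0_eq_zero_iff β θ hδ.ne' h0 h1).mpr h.2]
    ring
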